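/- Let H be a complete real inner product space and X ⊆ H a set with 0 ∈ X and diameter at most D (i.e., ‖y − z‖ ≤ D for all y, z ∈ X). For t = 1,…,T+1 let X_t ⊆ X be nonempty, closed, and convex. For t = 1,…,T let f_t : H → ℝ be convex and differentiable with ‖∇f_t(y)‖ ≤ G for all y ∈ X. Fix η > 0 and define iterates by: x_1 ∈ X_1; x'_{t+1} = x_t − η·∇f_t(x_t); x_{t+1} = Π_{X_{t+1}}(x'_{t+1}), where Π denotes metric projection. Let x̄_{t+1} = Π_{X_t}(x'_{t+1}), ζ_t = ‖x̄_{t+1} − x_{t+1}‖, and S_T = Σ_{t=1}^{T} ζ_t. Then for every comparator sequence v_t ∈ X_t (t = 1,…,T), with C_T = Σ_{t=2}^{T} ‖v_{t−1} − v_t‖, it holds that Σ_{t=1}^{T} f_t(x_t) − Σ_{t=1}^{T} f_t(v_t) ≤ (η·T·G²)/2 + (7·D²)/(4η) + (D·C_T)/η + (D·S_T)/η. -/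

import Mathlib

/-- `p` is the metric projection of `z` onto the set `C`: `p ∈ C` and `p`
minimizes the distance to `z` over `C`. -/
def IsMetricProj {H : Type*} [NormedAddCommGroup H] (C : Set H) (z p : H) : Prop :=
  p ∈ C ∧ ∀ y ∈ C, ‖z - p‖ ≤ ‖z - y‖

/-- First-order characterization of convexity, in terms of the gradient. -/
theorem ConvexOn.inner_gradient_le_sub {H : Type*} [NormedAddCommGroup H]
    [InnerProductSpace ℝ H] [CompleteSpace H] {f : H → ℝ}
    (hf : ConvexOn ℝ Set.univ f) {a : H} (hd : DifferentiableAt ℝ f a) (b : H) :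
    inner ℝ (gradient f a) (b - a) ≤ f b - f a := by
  have hline : ConvexOn ℝ Set.univ (f ∘ AffineMap.lineMap (k := ℝ) a b) := by
    simpa using hf.comp_affineMap (AffineMap.lineMap a b)
  have hderiv : HasDerivAt (f ∘ AffineMap.lineMap (k := ℝ) a b) (fderiv ℝ f a (b - a)) 0 := by
    refine HasFDerivAt.comp_hasDerivAt 0 ?_ AffineMap.hasDerivAt_lineMap
    simpa using hd.hasFDerivAt
  have := hline.le_slope_of_hasDerivAt (Set.mem_univ _) (Set.mem_univ _) one_pos hderiv
  simpa [inner_gradient_left, slope_def_field] using this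

/-- Metric projection onto a convex set does not increase the distance to points of the set. -/
theorem IsMetricProj.norm_sub_le {H : Type*} [NormedAddCommGroup H] [InnerProductSpace ℝ H]
    {C : Set H} (hC : Convex ℝ C) {z p : H} (hp : IsMetricProj C z p) {v : H} (hv : v ∈ C) :
    ‖p - v‖ ≤ ‖z - v‖ := by
  have : Nonempty C := ⟨⟨p, hp.1⟩⟩
  have hmin : ‖z - p‖ = ⨅ w : C, ‖z - w‖ :=
    le_antisymm (le_ciInf fun w => hp.2 w w.2)
      (ciInf_le ⟨0, by rintro _ ⟨w, rfl⟩; exact norm_nonneg _⟩ (⟨p, hp.1⟩ : C))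
  have hobtuse := (norm_eq_iInf_iff_real_inner_le_zero hC hp.1).1 hmin v hv
  have hexp := norm_sub_sq_real (z - p) (v - p)
  rw [sub_sub_sub_cancel_right, norm_sub_rev v p] at hexp
  nlinarith [norm_nonneg (z - v), norm_nonneg (p - v), sq_nonneg ‖z - p‖]

/-- One step of projected gradient descent on a convex function. -/
theorem IsMetricProj.gradient_step_le {H : Type*} [NormedAddCommGroup H]
    [InnerProductSpace ℝ H] [CompleteSpace H] {f : H → ℝ} (hf : ConvexOn ℝ Set.univ f)
    {C : Set H} (hC : Convex ℝ C) {a p v : H} (hd : DifferentiableAt ℝ f a) {η G : ℝ}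
    (hη : 0 < η) (hG : ‖gradient f a‖ ≤ G)
    (hp : IsMetricProj C (a - η • gradient f a) p) (hv : v ∈ C) :
    f a - f v ≤ η * G ^ 2 / 2 + (‖a - v‖ ^ 2 - ‖p - v‖ ^ 2) / (2 * η) := by
  have hfirst := hf.inner_gradient_le_sub hd v
  have hproj : ‖p - v‖ ^ 2 ≤ ‖a - η • gradient f a - v‖ ^ 2 :=
    pow_le_pow_left₀ (norm_nonneg _) (hp.norm_sub_le hC hv) 2
  have hexp := norm_sub_sq_real (a - v) (η • gradient f a)
  rw [sub_right_comm, inner_smul_right, norm_smul, Real.norm_of_nonneg hη.le, mul_pow,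
    real_inner_comm] at hexp
  rw [← neg_sub a v, inner_neg_right] at hfirst
  have hG2 : η ^ 2 * ‖gradient f a‖ ^ 2 ≤ η ^ 2 * G ^ 2 := by gcongr
  have hmul := mul_le_mul_of_nonneg_left hfirst hη.le
  have hsplit : η * G ^ 2 / 2 + (‖a - v‖ ^ 2 - ‖p - v‖ ^ 2) / (2 * η)
      = (η ^ 2 * G ^ 2 + ‖a - v‖ ^ 2 - ‖p - v‖ ^ 2) / (2 * η) := by
    field_simp
    ring
  rw [hsplit, le_div_iff₀ (by positivity)]
  linarith

/-- Squared distances between points of a set of diameter at most `D` are `2 * D`-Lipschitz in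
each argument. -/
theorem norm_sub_sq_le_add_two_mul {H : Type*} [SeminormedAddCommGroup H] {D : ℝ} {a b u v : H}
    (hau : ‖a - u‖ ≤ D) (hbv : ‖b - v‖ ≤ D) :
    ‖a - u‖ ^ 2 ≤ ‖b - v‖ ^ 2 + 2 * D * (‖b - a‖ + ‖v - u‖) := by
  have htri : ‖a - u‖ ≤ ‖b - v‖ + (‖b - a‖ + ‖v - u‖) := by
    calc ‖a - u‖ = ‖(b - v) - ((b - a) - (v - u))‖ := by congr 1; abel
      _ ≤ ‖b - v‖ + (‖b - a‖ + ‖v - u‖) :=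
        (norm_sub_le _ _).trans (by gcongr; exact norm_sub_le _ _)
  nlinarith [norm_nonneg (a - u), norm_nonneg (b - v), norm_nonneg (b - a), norm_nonneg (v - u)]

/-- **Dynamic regret bound of Safe Online Gradient Descent.**
`H` complete real inner product space, `X ⊆ H` with `0 ∈ X` and diameter at
most `D`, nonempty closed convex `X_t ⊆ X` (`t = 1,…,T+1`), convex
differentiable losses `f_t` with `‖∇f_t‖ ≤ G` on `X`, step size `η > 0`.
Iterates: `x_1 ∈ X_1`, `x'_{t+1} = x_t − η∇f_t(x_t)`,
`x_{t+1} = Π_{X_{t+1}}(x'_{t+1})`, and `x̄_{t+1} = Π_{X_t}(x'_{t+1})`,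
`ζ_t = ‖x̄_{t+1} − x_{t+1}‖`, `S_T = Σ_{t=1}^T ζ_t`. Then for every comparator
sequence `v_t ∈ X_t` with `C_T = Σ_{t=2}^T ‖v_{t−1} − v_t‖`,
`Σ f_t(x_t) − Σ f_t(v_t) ≤ ηTG²/2 + 7D²/(4η) + D·C_T/η + D·S_T/η`. -/
theorem safe_ogd_dynamic_regret {H : Type*}
    [NormedAddCommGroup H] [InnerProductSpace ℝ H] [CompleteSpace H]
    (T : ℕ) (D G η : ℝ) (hη : 0 < η)
    (Xbig : Set H) (h0 : (0 : H) ∈ Xbig)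
    (hdiam : ∀ y ∈ Xbig, ∀ z ∈ Xbig, ‖y - z‖ ≤ D)
    (X : ℕ → Set H)
    (hXsub : ∀ t, 1 ≤ t → t ≤ T + 1 → X t ⊆ Xbig)
    (hXne : ∀ t, 1 ≤ t → t ≤ T + 1 → (X t).Nonempty)
    (hXcl : ∀ t, 1 ≤ t → t ≤ T + 1 → IsClosed (X t))
    (hXcv : ∀ t, 1 ≤ t → t ≤ T + 1 → Convex ℝ (X t))
    (f : ℕ → H → ℝ)
    (hfcv : ∀ t, 1 ≤ t → t ≤ T → ConvexOn ℝ Set.univ (f t))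
    (hfd : ∀ t, 1 ≤ t → t ≤ T → Differentiable ℝ (f t))
    (hfg : ∀ t, 1 ≤ t → t ≤ T → ∀ y ∈ Xbig, ‖gradient (f t) y‖ ≤ G)
    (x xbar : ℕ → H)
    (hx1 : x 1 ∈ X 1)
    (hproj : ∀ t, 1 ≤ t → t ≤ T →
      IsMetricProj (X (t + 1)) (x t - η • gradient (f t) (x t)) (x (t + 1)))
    (hbar : ∀ t, 1 ≤ t → t ≤ T →
      IsMetricProj (X t) (x t - η • gradient (f t) (x t)) (xbar (t + 1)))
    (v : ℕ → H) (hv : ∀ t, 1 ≤ t → t ≤ T → v t ∈ X t) :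
    ∑ t ∈ Finset.Icc 1 T, f t (x t) - ∑ t ∈ Finset.Icc 1 T, f t (v t)
      ≤ η * T * G ^ 2 / 2 + 7 * D ^ 2 / (4 * η)
        + D * (∑ t ∈ Finset.Icc 2 T, ‖v (t - 1) - v t‖) / η
        + D * (∑ t ∈ Finset.Icc 1 T, ‖xbar (t + 1) - x (t + 1)‖) / η := by
  have hD : 0 ≤ D := (norm_nonneg _).trans (hdiam 0 h0 0 h0)
  have hxX : ∀ t, 1 ≤ t → t ≤ T + 1 → x t ∈ Xbig := by
    intro t h1 hT
    refine hXsub t h1 hT ?_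
    obtain rfl | h := h1.eq_or_lt
    · exact hx1
    · obtain ⟨s, rfl⟩ := Nat.exists_eq_add_of_le' h1
      exact (hproj s (by omega) (by omega)).1
  have hvX : ∀ t, 1 ≤ t → t ≤ T → v t ∈ Xbig := fun t h1 hT =>
    hXsub t h1 (by omega) (hv t h1 hT)
  have hbarX : ∀ t, 1 ≤ t → t ≤ T → xbar (t + 1) ∈ Xbig := fun t h1 hT =>
    hXsub t h1 (by omega) (hbar t h1 hT).1
  have hstep : ∀ t, 1 ≤ t → t ≤ T → f t (x t) - f t (v t)
      ≤ η * G ^ 2 / 2 + (‖x t - v t‖ ^ 2 - ‖xbar (t + 1) - v t‖ ^ 2) / (2 * η) :=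
    fun t h1 hT => (hbar t h1 hT).gradient_step_le (hfcv t h1 hT) (hXcv t h1 (by omega))
      (hfd t h1 hT).differentiableAt hη (hfg t h1 hT _ (hxX t h1 (by omega))) (hv t h1 hT)
  -- The potential `‖xbar (n + 1) - v n‖ ^ 2` is kept on the right so that the sum telescopes.
  have hsum : ∀ n, 1 ≤ n → n ≤ T →
      ∑ t ∈ Finset.Icc 1 n, f t (x t) - ∑ t ∈ Finset.Icc 1 n, f t (v t)
        ≤ η * n * G ^ 2 / 2 + (D ^ 2 - ‖xbar (n + 1) - v n‖ ^ 2) / (2 * η)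
          + D * (∑ t ∈ Finset.Icc 2 n, ‖v (t - 1) - v t‖) / η
          + D * (∑ t ∈ Finset.Icc 1 n, ‖xbar (t + 1) - x (t + 1)‖
              - ‖xbar (n + 1) - x (n + 1)‖) / η := by
    intro n h1
    induction n, h1 using Nat.le_induction with
    | base =>
      intro hT
      have h := hstep 1 le_rfl hT
      have hsq : ‖x 1 - v 1‖ ^ 2 ≤ D ^ 2 := by
        gcongr
        exact hdiam _ (hxX 1 le_rfl (by omega)) _ (hvX 1 le_rfl hT)
      have hdiv : (‖x 1 - v 1‖ ^ 2 - ‖xbar (1 + 1) - v 1‖ ^ 2) / (2 * η)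
          ≤ (D ^ 2 - ‖xbar (1 + 1) - v 1‖ ^ 2) / (2 * η) := by gcongr
      simp at h hdiv ⊢
      linarith
    | succ n h1 ih =>
      intro hT
      have h := hstep (n + 1) (by omega) hT
      have hprev := ih (by omega)
      have hsq := norm_sub_sq_le_add_two_mul
        (hdiam _ (hxX (n + 1) (by omega) (by omega)) _ (hvX (n + 1) (by omega) hT))
        (hdiam _ (hbarX n h1 (by omega)) _ (hvX n h1 (by omega)))
      have hdiv := div_le_div_of_nonneg_right hsq (by positivity : 0 ≤ 2 * η)
      rw [add_div, mul_assoc 2 D, mul_div_mul_left _ _ two_ne_zero] at hdiv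
      rw [Finset.sum_Icc_succ_top (by omega), Finset.sum_Icc_succ_top (by omega),
        Finset.sum_Icc_succ_top (by omega), Finset.sum_Icc_succ_top (by omega)]
      push_cast
      simp only [mul_add, mul_sub, add_div, sub_div, mul_one,
        add_mul] at *
      linarith
  have hζ : 0 ≤ D * ‖xbar (T + 1) - x (T + 1)‖ / η := by positivity
  have hb : 0 ≤ ‖xbar (T + 1) - v T‖ ^ 2 / (2 * η) := by positivity
  have hDD : D ^ 2 / (2 * η) ≤ 7 * D ^ 2 / (4 * η) := by
    rw [div_le_div_iff₀ (by positivity) (by positivity)]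
    nlinarith [mul_nonneg (sq_nonneg D) hη.le]
  obtain rfl | hT := T.eq_zero_or_pos
  · simp
    positivity
  · have h := hsum T hT le_rfl
    rw [mul_sub, sub_div, sub_div] at h
    linarith
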